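/- arXiv:1309.5862 — 2 statements merged into one kernel-verified Lean document; each statement's English description precedes it below -/
import Mathlib

section
/- Let β(n) = n^{α(n)} with a nondecreasing, e-consistent function α : ℕ → ℕ such that 1 ≤ₐₑ α(n) and α(n) ≤ₐₑ log(n). Then It(β) ≡ₐₑ {n ↦ n^{(α(n))^l} : l ≥ 1}. Moreover, if β_i(n) = n^{α_i(n)} for i = 1, 2 with nondecreasing, e-consistent α_i satisfying 1 ≤ₐₑ α_i(n) ≤ₐₑ log(n), then β₁ ≤it β₂ iff α₁ ≤pow α₂, β₁ <it β₂ iff α₁ <pow α₂, and from 2 ≤ₐₑ α₁ and α₁ ≪pow α₂ it follows that β₁ <it β₂. -/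
open Filter

/-- A bound function (time bound): `n ≤ β n ≤ β (n+1)` for all `n`. -/
def IsBound (β : ℕ → ℕ) : Prop := ∀ n : ℕ, n ≤ β n ∧ β n ≤ β (n + 1)

/-- `f ≤ₐₑ g` : `f n ≤ g n` for all sufficiently large `n`. -/
def AEle (f g : ℕ → ℕ) : Prop := ∀ᶠ n in atTop, f n ≤ g n

/-- `f ≤o g` : there is a constant `c ≥ 1` with `f ≤ₐₑ c·g`. -/
def LeO (f g : ℕ → ℕ) : Prop := ∃ c : ℕ, 1 ≤ c ∧ AEle f (fun n => c * g n)

/-- `f = o(g)` : `f n / g n → 0`. -/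
def LittleO (f g : ℕ → ℕ) : Prop :=
  Tendsto (fun n => (f n : ℝ) / (g n : ℝ)) atTop (nhds 0)

/-- `β` is superlinear : `β n / n → ∞`. -/
def Superlinear (β : ℕ → ℕ) : Prop :=
  Tendsto (fun n => (β n : ℝ) / (n : ℝ)) atTop atTop

/-- A set of bounds is tame iff for any two members the sequence of quotients
converges to a limit in `ℝ ∪ {∞}`. -/
def Tame (U : Set (ℕ → ℕ)) : Prop :=
  ∀ β₁ ∈ U, ∀ β₂ ∈ U,
    (∃ L : ℝ, Tendsto (fun n => (β₁ n : ℝ) / (β₂ n : ℝ)) atTop (nhds L)) ∨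
      Tendsto (fun n => (β₁ n : ℝ) / (β₂ n : ℝ)) atTop atTop

/-- `B₁ ≤ₐₑ B₂` for sets of bounds. -/
def SetLeAE (B₁ B₂ : Set (ℕ → ℕ)) : Prop := ∀ β₁ ∈ B₁, ∃ β₂ ∈ B₂, AEle β₁ β₂

/-- `B₁ ≡ₐₑ B₂` (confinality). -/
def SetEquivAE (B₁ B₂ : Set (ℕ → ℕ)) : Prop := SetLeAE B₁ B₂ ∧ SetLeAE B₂ B₁

/-- `B₁ ≤o B₂` for sets of bounds. -/
def SetLeO (B₁ B₂ : Set (ℕ → ℕ)) : Prop := ∀ β₁ ∈ B₁, ∃ β₂ ∈ B₂, LeO β₁ β₂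

/-- `It β` : the set of `m`-fold iterates of `β`, `m ≥ 1`. -/
def It (β : ℕ → ℕ) : Set (ℕ → ℕ) := {g | ∃ m : ℕ, 1 ≤ m ∧ g = β^[m]}

/-- `It B = ⋃_{β ∈ B} It β`. -/
def ItS (B : Set (ℕ → ℕ)) : Set (ℕ → ℕ) := ⋃ β ∈ B, It β

/-- `β₁ ≤it β₂` iff `It β₁ ≤ₐₑ It β₂`. -/
def LeIt (β₁ β₂ : ℕ → ℕ) : Prop := SetLeAE (It β₁) (It β₂)

/-- `β₁ <it β₂` iff `β₁ ≤it β₂` but not `β₂ ≤it β₁`. -/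
def LtIt (β₁ β₂ : ℕ → ℕ) : Prop := LeIt β₁ β₂ ∧ ¬ LeIt β₂ β₁

/-- `α₁ ≤pow α₂` : for each `k` there is `l` with `α₁^k ≤ₐₑ α₂^l` (pointwise powers). -/
def PowLe (α₁ α₂ : ℕ → ℕ) : Prop :=
  ∀ k : ℕ, ∃ l : ℕ, AEle (fun n => α₁ n ^ k) (fun n => α₂ n ^ l)

/-- `α₁ <pow α₂`. -/
def PowLt (α₁ α₂ : ℕ → ℕ) : Prop := PowLe α₁ α₂ ∧ ¬ PowLe α₂ α₁

/-- `α₁ ≪pow α₂` : `α₁^k ≤ₐₑ α₂` for every `k`. -/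
def PowLL (α₁ α₂ : ℕ → ℕ) : Prop := ∀ k : ℕ, AEle (fun n => α₁ n ^ k) α₂

/-- f-consistency: to any `k` there is `l` with `α(n^k) ≤ (α n)^l` for almost all `n`. -/
def FCons (α : ℕ → ℕ) : Prop := ∀ k : ℕ, ∃ l : ℕ, ∀ᶠ n in atTop, α (n ^ k) ≤ α n ^ l

/-- The paper's `log`: `⌈log₂ n⌉` for `n ≥ 2`, and `log 0 = log 1 = 1`. -/
def plog (n : ℕ) : ℕ := max 1 (Nat.clog 2 n)

/-- e-consistency: to any `k` there is `l` with `α(n^{(log n)^k}) ≤ (α n)^l` for almost all `n`. -/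
def ECons (α : ℕ → ℕ) : Prop :=
  ∀ k : ℕ, ∃ l : ℕ, ∀ᶠ n in atTop, α (n ^ (plog n ^ k)) ≤ α n ^ l

/-- The iterated logarithm `log* n = min {m ≥ 1 : log^⟨m⟩ n = 1}`. -/
noncomputable def logstar (n : ℕ) : ℕ := sInf {m : ℕ | 1 ≤ m ∧ plog^[m] n = 1}

/-- The set of linear bounds. -/
def Blin : Set (ℕ → ℕ) := {β | ∃ c : ℕ, 1 ≤ c ∧ β = fun n => c * n}

/-- Condition (ii) of regularity: for all `β, β' ∈ B` there is `β'' ∈ B` with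
`β + β' ∘ β ≤ₐₑ β''`. -/
def CompCond (B : Set (ℕ → ℕ)) : Prop :=
  ∀ β ∈ B, ∀ β' ∈ B, ∃ β'' ∈ B, AEle (fun n => β n + β' (β n)) β''

theorem aux_beta_mono {α : ℕ → ℕ} (hm : Monotone α) {a b : ℕ} (ha : 1 ≤ a) (hab : a ≤ b) :
    a ^ α a ≤ b ^ α b :=
  (Nat.pow_le_pow_left hab _).trans (Nat.pow_le_pow_right (ha.trans hab) (hm hab))

theorem aux_lower {α : ℕ → ℕ} (hm : Monotone α) (n : ℕ) (hn : 1 ≤ n) (h1 : 1 ≤ α n) (m : ℕ) :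
    n ^ (α n ^ m) ≤ (fun n => n ^ α n)^[m] n := by
  induction m with
  | zero => simp
  | succ m ih =>
    rw [Function.iterate_succ_apply']
    refine le_trans ?_ (aux_beta_mono hm (Nat.one_le_pow _ _ hn) ih)
    rw [← pow_mul, pow_succ]
    refine Nat.pow_le_pow_right hn (Nat.mul_le_mul_left _ (hm ?_))
    exact Nat.le_self_pow (Nat.pos_iff_ne_zero.mp (Nat.one_le_pow _ _ h1)) n

theorem aux_upper {α : ℕ → ℕ} (hm : Monotone α) (he : ECons α)
    (h1 : AEle (fun _ => 1) α) (hl : AEle α plog) (m : ℕ) :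
    ∃ l : ℕ, 1 ≤ l ∧ AEle (fun n => n ^ α n)^[m] (fun n => n ^ (α n ^ l)) := by
  induction m with
  | zero =>
    refine ⟨1, le_rfl, ?_⟩
    unfold AEle at *
    filter_upwards [h1] with n h1n
    simpa using Nat.le_self_pow (by omega) n
  | succ m ih =>
    obtain ⟨l, hl1, ih⟩ := ih
    obtain ⟨l', he⟩ := he l
    refine ⟨l + l', by omega, ?_⟩
    unfold AEle at *
    filter_upwards [ih, he, h1, hl, eventually_ge_atTop 1] with n ihn hen h1n hln hn
    rw [Function.iterate_succ_apply']
    have hpos : 1 ≤ (fun n => n ^ α n)^[m] n :=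
      (Nat.one_le_pow _ _ hn).trans (aux_lower hm n hn h1n m)
    refine (aux_beta_mono hm hpos ihn).trans ?_
    rw [← pow_mul, pow_add]
    refine Nat.pow_le_pow_right hn (Nat.mul_le_mul_left _ (le_trans (hm ?_) hen))
    exact Nat.pow_le_pow_right hn (Nat.pow_le_pow_left hln _)

theorem aux_leIt {α₁ α₂ : ℕ → ℕ} (hm₁ : Monotone α₁) (hm₂ : Monotone α₂)
    (he₁ : ECons α₁) (he₂ : ECons α₂)
    (h1₁ : AEle (fun _ => 1) α₁) (hl₁ : AEle α₁ plog)
    (h1₂ : AEle (fun _ => 1) α₂) (hl₂ : AEle α₂ plog) :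
    LeIt (fun n => n ^ α₁ n) (fun n => n ^ α₂ n) ↔ PowLe α₁ α₂ := by
  constructor
  · intro h k
    obtain ⟨g, ⟨m, hm, rfl⟩, hg⟩ := h _ ⟨k + 1, by omega, rfl⟩
    obtain ⟨l, hl, hu⟩ := aux_upper hm₂ he₂ h1₂ hl₂ m
    refine ⟨l, ?_⟩
    unfold AEle at *
    filter_upwards [hg, hu, h1₁, eventually_ge_atTop 2] with n hgn hun h1n hn
    have h3 := ((aux_lower hm₁ n (by omega) h1n (k + 1)).trans hgn).trans hun
    have h4 := (Nat.pow_le_pow_iff_right (by omega)).mp h3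
    exact (Nat.pow_le_pow_right h1n (Nat.le_succ k)).trans h4
  · rintro h g ⟨m, hm, rfl⟩
    obtain ⟨k, hk, hu⟩ := aux_upper hm₁ he₁ h1₁ hl₁ m
    obtain ⟨l, hl⟩ := h k
    refine ⟨_, ⟨l + 1, by omega, rfl⟩, ?_⟩
    unfold AEle at *
    filter_upwards [hu, hl, h1₂, eventually_ge_atTop 1] with n hun hln h1n hn
    refine hun.trans (le_trans ?_ (aux_lower hm₂ n hn h1n (l + 1)))
    exact Nat.pow_le_pow_right hn (hln.trans (Nat.pow_le_pow_right h1n (Nat.le_succ l)))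

theorem stmt14 :
    (∀ α : ℕ → ℕ, Monotone α → ECons α →
      AEle (fun _ => 1) α → AEle α plog →
      SetEquivAE (It (fun n => n ^ α n)) {g | ∃ l : ℕ, 1 ≤ l ∧ g = fun n => n ^ (α n ^ l)}) ∧
    (∀ α₁ α₂ : ℕ → ℕ, Monotone α₁ → Monotone α₂ → ECons α₁ → ECons α₂ →
      AEle (fun _ => 1) α₁ → AEle α₁ plog →
      AEle (fun _ => 1) α₂ → AEle α₂ plog →
      ((LeIt (fun n => n ^ α₁ n) (fun n => n ^ α₂ n) ↔ PowLe α₁ α₂) ∧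
       (LtIt (fun n => n ^ α₁ n) (fun n => n ^ α₂ n) ↔ PowLt α₁ α₂) ∧
       (AEle (fun _ => 2) α₁ → PowLL α₁ α₂ →
         LtIt (fun n => n ^ α₁ n) (fun n => n ^ α₂ n)))) := by
  refine ⟨?_, ?_⟩
  · intro α hm he h1 hl
    constructor
    · rintro g ⟨m, -, rfl⟩
      obtain ⟨l, hl1, hu⟩ := aux_upper hm he h1 hl m
      exact ⟨_, ⟨l, hl1, rfl⟩, hu⟩
    · rintro g ⟨l, hl1, rfl⟩
      refine ⟨_, ⟨l, hl1, rfl⟩, ?_⟩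
      unfold AEle at *
      filter_upwards [h1, eventually_ge_atTop 1] with n h1n hn
      exact aux_lower hm n hn h1n l
  · intro α₁ α₂ hm₁ hm₂ he₁ he₂ h1₁ hl₁ h1₂ hl₂
    have h12 := aux_leIt hm₁ hm₂ he₁ he₂ h1₁ hl₁ h1₂ hl₂
    have h21 := aux_leIt hm₂ hm₁ he₂ he₁ h1₂ hl₂ h1₁ hl₁
    have hlt : LtIt (fun n => n ^ α₁ n) (fun n => n ^ α₂ n) ↔ PowLt α₁ α₂ :=
      and_congr h12 (not_congr h21)
    refine ⟨h12, hlt, ?_⟩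
    intro h2 hll
    refine hlt.mpr ⟨fun k => ⟨1, by simpa using hll k⟩, fun hle => ?_⟩
    obtain ⟨l, hl⟩ := hle 1
    have hk := hll (l + 1)
    unfold AEle at *
    obtain ⟨n, hln, hkn, h2n⟩ := (hl.and (hk.and h2)).exists
    beta_reduce at hln hkn h2n
    have h5 : α₁ n ^ l < α₁ n ^ (l + 1) := Nat.pow_lt_pow_right (by omega) (Nat.lt_succ_self l)
    simp only [pow_one] at hln
    omega
end

section
/- There exists a set U₂ of bound functions, each of the form β(n) = n^{α(n)} with α : ℕ → ℕ nondecreasing, e-consistent and satisfying 2 ≤ₐₑ α(n) ≤ₐₑ log(n), such that: (1) U₂ is tame; (2) U₂ contains the functions n ↦ n² and n ↦ n^{log(n)}; (3) U₂ is densely linearly ordered by ≤it, i.e. any two distinct β₁, β₂ ∈ U₂ satisfy β₁ <it β₂ or β₂ <it β₁, and whenever β₁ <it β₂ for β₁, β₂ ∈ U₂ there is β₃ ∈ U₂ with β₁ <it β₃ <it β₂; (4) for β_i(n) = n^{α_i(n)} with β₁, β₂ ∈ U₂ it holds: β₁ <it β₂ iff α₁ ≪pow α₂. -/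
open Filter

def xx (n : ℕ) : ℕ := Nat.log 2 (plog n)

noncomputable def ff (q : ℝ) (x : ℕ) : ℕ := ⌊(x : ℝ) ^ q⌋₊

noncomputable def aa (q : ℝ) (n : ℕ) : ℕ := if q < 1 then 2 ^ ff q (xx n) else plog n

noncomputable def bb (q : ℝ) (n : ℕ) : ℕ := n ^ aa q n

lemma plog_mono : Monotone plog := fun a b h =>
  max_le_max le_rfl (Nat.clog_mono_right 2 h)

lemma plog_pos (n : ℕ) : 1 ≤ plog n := le_max_left _ _

lemma le_two_pow_plog (n : ℕ) : n ≤ 2 ^ plog n :=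
  (Nat.le_pow_clog (by norm_num) n).trans
    (Nat.pow_le_pow_right (by norm_num) (le_max_right _ _))

lemma plog_pow (n k : ℕ) : plog (n ^ (plog n ^ k)) ≤ plog n ^ (k + 1) := by
  refine max_le (Nat.one_le_pow _ _ (plog_pos n)) ?_
  refine Nat.clog_le_of_le_pow ?_
  calc n ^ (plog n ^ k) ≤ (2 ^ plog n) ^ (plog n ^ k) := Nat.pow_le_pow_left (le_two_pow_plog n) _
    _ = 2 ^ plog n ^ (k + 1) := by rw [← pow_mul]; ring_nf

lemma plog_tendsto : Tendsto plog atTop atTop := by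
  refine tendsto_atTop.2 fun b => ?_
  filter_upwards [eventually_ge_atTop (2 ^ b)] with n hn
  have := hn.trans (le_two_pow_plog n)
  exact (Nat.pow_le_pow_iff_right (by norm_num)).1 this

lemma xx_mono : Monotone xx := fun a b h => Nat.log_mono_right (plog_mono h)

lemma xx_tendsto : Tendsto xx atTop atTop := by
  refine Tendsto.comp ?_ plog_tendsto
  refine tendsto_atTop.2 fun b => ?_
  filter_upwards [eventually_ge_atTop (2 ^ b)] with n hn
  exact Nat.le_log_of_pow_le (by norm_num) hn

lemma two_pow_xx (n : ℕ) : 2 ^ xx n ≤ plog n :=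
  Nat.pow_log_le_self 2 (Nat.one_le_iff_ne_zero.1 (plog_pos n))

lemma ff_mono {q : ℝ} (hq : 0 ≤ q) : Monotone (ff q) := fun a b h =>
  Nat.floor_mono (Real.rpow_le_rpow (by positivity) (by exact_mod_cast h) hq)

lemma ff_le {q : ℝ} (hq1 : q ≤ 1) {x : ℕ} (hx : 1 ≤ x) : ff q x ≤ x := by
  refine Nat.floor_le_of_le ?_
  calc (x : ℝ) ^ q ≤ (x : ℝ) ^ (1 : ℝ) :=
        Real.rpow_le_rpow_of_exponent_le (by exact_mod_cast hx) hq1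
    _ = x := Real.rpow_one _

lemma ff_ge {q : ℝ} (hq : 0 ≤ q) {x : ℕ} (hx : 1 ≤ x) : 1 ≤ ff q x := by
  refine Nat.le_floor ?_
  simpa using Real.one_le_rpow (by exact_mod_cast hx : (1 : ℝ) ≤ x) hq

lemma xx_pow (k n : ℕ) (h : 1 ≤ xx n) : xx (n ^ (plog n ^ k)) ≤ 2 * (k + 1) * xx n := by
  have h1 : xx (n ^ (plog n ^ k)) ≤ Nat.log 2 (plog n ^ (k + 1)) :=
    Nat.log_mono_right (plog_pow n k)
  have h2 : plog n < 2 ^ (xx n + 1) := Nat.lt_pow_succ_log_self (by norm_num) _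
  have h3 : plog n ^ (k + 1) ≤ 2 ^ ((xx n + 1) * (k + 1)) := by
    rw [pow_mul]; exact Nat.pow_le_pow_left h2.le _
  have h4 : Nat.log 2 (plog n ^ (k + 1)) ≤ (xx n + 1) * (k + 1) := by
    have := Nat.log_mono_right (b := 2) h3
    rwa [Nat.log_pow (by norm_num)] at this
  nlinarith

lemma ff_mul {q : ℝ} (hq : 0 ≤ q) (hq1 : q ≤ 1) {x c : ℕ} (hx : 1 ≤ x) (hc : 1 ≤ c) :
    ff q (c * x) ≤ 2 * c * ff q x := by
  have hf := ff_ge hq hx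
  refine Nat.floor_le_of_le ?_
  have h1 : (x : ℝ) ^ q < ff q x + 1 := Nat.lt_floor_add_one _
  have h2 : (c : ℝ) ^ q ≤ c := by
    calc (c : ℝ) ^ q ≤ (c : ℝ) ^ (1 : ℝ) :=
        Real.rpow_le_rpow_of_exponent_le (by exact_mod_cast hc) hq1
    _ = c := Real.rpow_one _
  have hf' : (1 : ℝ) ≤ ff q x := by exact_mod_cast hf
  push_cast
  rw [Real.mul_rpow (by positivity) (by positivity)]
  calc (c : ℝ) ^ q * (x : ℝ) ^ q ≤ c * (2 * ff q x) :=
        mul_le_mul h2 (by linarith) (by positivity) (by positivity)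
    _ = _ := by ring

lemma aa_mono {q : ℝ} (hq : 0 ≤ q) : Monotone (aa q) := by
  intro a b h
  unfold aa
  split_ifs
  · exact Nat.pow_le_pow_right (by norm_num) (ff_mono hq (xx_mono h))
  · exact plog_mono h

lemma aa_pos (q : ℝ) (n : ℕ) : 1 ≤ aa q n := by
  unfold aa
  split_ifs
  · exact Nat.one_le_two_pow
  · exact plog_pos n

lemma ev_xx : ∀ᶠ n in atTop, 1 ≤ xx n := xx_tendsto.eventually_ge_atTop 1

lemma aa_econs {q : ℝ} (hq : 0 ≤ q) : ECons (aa q) := by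
  intro k
  by_cases h : q < 1
  · refine ⟨2 * (2 * (k + 1)), ?_⟩
    filter_upwards [ev_xx] with n hn
    simp only [aa, h, if_true]
    rw [← pow_mul]
    refine Nat.pow_le_pow_right (by norm_num) ?_
    calc _ ≤ ff q (2 * (k + 1) * xx n) := ff_mono hq (xx_pow k n hn)
      _ ≤ _ := by rw [mul_comm]; rw [mul_comm (ff q _)]; rw [mul_comm (xx n)]; exact ff_mul hq h.le hn (by omega)
  · refine ⟨k + 1, Eventually.of_forall fun n => ?_⟩
    simp only [aa, h, if_false]
    exact plog_pow n k

lemma aa_two {q : ℝ} (hq : 0 ≤ q) : ∀ᶠ n in atTop, 2 ≤ aa q n := by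
  by_cases h : q < 1
  · filter_upwards [ev_xx] with n hn
    simp only [aa, h, if_true]
    exact Nat.le_self_pow (Nat.one_le_iff_ne_zero.1 (ff_ge hq hn)) 2
  · simp only [aa, h, if_false]
    exact plog_tendsto.eventually_ge_atTop 2

lemma form_le {q : ℝ} (hq1 : q ≤ 1) : ∀ᶠ n in atTop, 2 ^ ff q (xx n) ≤ aa q n := by
  filter_upwards [ev_xx] with n hn
  unfold aa
  split_ifs
  · rfl
  · exact (Nat.pow_le_pow_right (by norm_num) (ff_le hq1 hn)).trans (two_pow_xx n)

lemma aa_plog {q : ℝ} : ∀ᶠ n in atTop, aa q n ≤ plog n := by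
  filter_upwards [ev_xx] with n hn
  unfold aa
  split_ifs with h
  · exact (Nat.pow_le_pow_right (by norm_num) (ff_le h.le hn)).trans (two_pow_xx n)
  · rfl

lemma aa_powLL {p q : ℝ} (hpq : p < q) (hq1 : q ≤ 1) : PowLL (aa p) (aa q) := by
  intro k
  have ht : Tendsto (fun n => ((xx n : ℕ) : ℝ) ^ (q - p)) atTop atTop :=
    (tendsto_rpow_atTop (by linarith)).comp (tendsto_natCast_atTop_atTop.comp xx_tendsto)
  filter_upwards [ev_xx, form_le hq1, ht.eventually_ge_atTop (k : ℝ)] with n hn h1 h2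
  refine le_trans ?_ h1
  simp only [aa, hpq.trans_le hq1, if_true]
  rw [← pow_mul]
  refine Nat.pow_le_pow_right (by norm_num) ?_
  refine Nat.le_floor ?_
  have hx : (0 : ℝ) < xx n := by exact_mod_cast hn
  push_cast
  calc (ff p (xx n) : ℝ) * k ≤ (xx n : ℝ) ^ p * (xx n : ℝ) ^ (q - p) :=
        mul_le_mul (Nat.floor_le (by positivity)) h2 (by positivity) (by positivity)
    _ = _ := by rw [← Real.rpow_add hx]; ring_nf

lemma bb_bound {q : ℝ} : ∀ n, n ≤ bb q n := fun n =>
  Nat.le_self_pow (Nat.one_le_iff_ne_zero.1 (aa_pos q n)) n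

lemma bb_mono {q : ℝ} (hq : 0 ≤ q) : Monotone (bb q) := by
  intro a b h
  rcases Nat.eq_zero_or_pos b with rfl | hb
  · simp [Nat.le_zero.1 h]
  · exact (Nat.pow_le_pow_left h _).trans (Nat.pow_le_pow_right hb (aa_mono hq h))

lemma bb_iter {q : ℝ} (hq : 0 ≤ q) (m : ℕ) :
    ∃ L, ∀ᶠ n in atTop, (bb q)^[m] n ≤ n ^ (aa q n ^ L) := by
  induction m with
  | zero => exact ⟨0, Eventually.of_forall fun n => by simp⟩
  | succ m ih =>
    obtain ⟨L, hL⟩ := ih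
    obtain ⟨l, hl⟩ := aa_econs hq L
    refine ⟨L + l, ?_⟩
    filter_upwards [hL, hl, aa_plog (q := q), eventually_ge_atTop 1] with n h1 h2 h3 h4
    rw [Function.iterate_succ_apply']
    have h5 : n ^ (aa q n ^ L) ≤ n ^ (plog n ^ L) :=
      Nat.pow_le_pow_right h4 (Nat.pow_le_pow_left h3 _)
    have h6 : aa q (n ^ (aa q n ^ L)) ≤ aa q n ^ l := (aa_mono hq h5).trans h2
    calc bb q ((bb q)^[m] n) ≤ bb q (n ^ (aa q n ^ L)) := bb_mono hq h1
      _ = n ^ (aa q n ^ L * aa q (n ^ (aa q n ^ L))) := by rw [bb, ← pow_mul]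
      _ ≤ n ^ (aa q n ^ (L + l)) := by
        refine Nat.pow_le_pow_right h4 ?_
        rw [pow_add]
        exact Nat.mul_le_mul_left _ h6

lemma bb_ltIt {p q : ℝ} (hp : 0 ≤ p) (hpq : p < q) (hq1 : q ≤ 1) : LtIt (bb p) (bb q) := by
  have hq : 0 ≤ q := hp.trans hpq.le
  constructor
  · rintro _ ⟨m, hm, rfl⟩
    refine ⟨_, ⟨m, hm, rfl⟩, ?_⟩
    obtain ⟨N, hN⟩ := eventually_atTop.1 (aa_powLL hpq hq1 1)
    filter_upwards [eventually_ge_atTop N, eventually_ge_atTop 1] with n hn hn1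
    clear hm
    have hge : ∀ m, n ≤ (bb p)^[m] n := by
      intro m
      induction m with
      | zero => simp
      | succ m ih => rw [Function.iterate_succ_apply']; exact ih.trans (bb_bound _)
    induction m with
    | zero => simp
    | succ m ih =>
      rw [Function.iterate_succ_apply', Function.iterate_succ_apply']
      refine le_trans ?_ (bb_mono hq ih)
      have := hN _ (hn.trans (hge m))
      simp only [pow_one] at this
      exact Nat.pow_le_pow_right (hn1.trans (hge m)) this
  · intro h
    obtain ⟨_, ⟨m, -, rfl⟩, hm⟩ := h (bb q) ⟨1, le_rfl, rfl⟩
    obtain ⟨L, hL⟩ := bb_iter hp m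
    obtain ⟨n, h1, h2, h3, h4, h5⟩ := (hm.and (hL.and ((aa_powLL hpq hq1 (L + 1)).and
      ((aa_two hp).and (eventually_ge_atTop 2))))).exists
    have h6 : aa q n ≤ aa p n ^ L := (Nat.pow_le_pow_iff_right h5).1 (h1.trans h2)
    have h7 : aa p n ^ (L + 1) ≤ aa p n ^ L := le_trans h3 h6
    exact absurd h7 (not_le.2 (Nat.pow_lt_pow_right h4 (Nat.lt_succ_self L)))

lemma aa_step {p q : ℝ} (hp : 0 ≤ p) (hpq : p < q) (hq1 : q ≤ 1) :
    ∀ᶠ n : ℕ in atTop, (n : ℝ) * bb p n ≤ bb q n := by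
  filter_upwards [aa_powLL hpq hq1 2, aa_two hp, eventually_ge_atTop 1] with n h1 h2 h3
  have : aa p n + 1 ≤ aa q n := by
    have : aa p n ^ 2 ≤ aa q n := h1
    nlinarith
  have h : n * bb p n ≤ bb q n := by
    calc n * bb p n = n ^ (aa p n + 1) := by rw [bb, pow_succ, mul_comm]
      _ ≤ _ := Nat.pow_le_pow_right h3 this
  exact_mod_cast h

lemma bb_pos {q : ℝ} {n : ℕ} (hn : 1 ≤ n) : (0 : ℝ) < bb q n := by
  exact_mod_cast hn.trans (bb_bound n)

lemma not_ltIt {β γ : ℕ → ℕ} (h : LtIt β γ) : ¬ LtIt γ β := fun h' => h'.2 h.1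

lemma powLL_congr {a b a' b' : ℕ → ℕ} (h : PowLL a b) (ha : ∀ n, 2 ≤ n → a' n = a n)
    (hb : ∀ n, 2 ≤ n → b' n = b n) : PowLL a' b' := by
  intro k
  filter_upwards [h k, eventually_ge_atTop 2] with n h1 h2
  rw [ha n h2, hb n h2]; exact h1

lemma powLL_lt {p q : ℝ} (hp : 0 ≤ p) (hq : 0 ≤ q) (hp1 : p ≤ 1) 
    (h : PowLL (aa p) (aa q)) : p < q := by
  by_contra hc
  have h' : AEle (aa q) (aa p) := by
    rcases (not_lt.1 hc).lt_or_eq with hlt | rfl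
    · filter_upwards [aa_powLL hlt hp1 1] with n hn
      simpa using hn
    · exact Eventually.of_forall fun n => le_rfl
  obtain ⟨n, h1, h2, h3⟩ := ((h 2).and (h'.and (aa_two hp))).exists
  have h1 : aa p n ^ 2 ≤ aa q n := h1
  nlinarith

theorem stmt17 :
    ∃ U₂ : Set (ℕ → ℕ),
      (∀ β ∈ U₂, IsBound β ∧
        ∃ α : ℕ → ℕ, Monotone α ∧ ECons α ∧
          AEle (fun _ => 2) α ∧ AEle α plog ∧ β = fun n => n ^ α n) ∧
      Tame U₂ ∧
      ((fun n => n ^ 2) ∈ U₂ ∧ (fun n => n ^ plog n) ∈ U₂) ∧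
      (∀ β₁ ∈ U₂, ∀ β₂ ∈ U₂, β₁ ≠ β₂ → LtIt β₁ β₂ ∨ LtIt β₂ β₁) ∧
      (∀ β₁ ∈ U₂, ∀ β₂ ∈ U₂, LtIt β₁ β₂ → ∃ β₃ ∈ U₂, LtIt β₁ β₃ ∧ LtIt β₃ β₂) ∧
      (∀ α₁ α₂ : ℕ → ℕ,
        (fun n => n ^ α₁ n) ∈ U₂ → (fun n => n ^ α₂ n) ∈ U₂ →
        (LtIt (fun n => n ^ α₁ n) (fun n => n ^ α₂ n) ↔ PowLL α₁ α₂)) := by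
  have key : ∀ p q : ℝ, 0 ≤ p → 0 ≤ q → p ≤ 1 → q ≤ 1 → LtIt (bb p) (bb q) → p < q := by
    intro p q hp hq hp1 hq1 h
    rcases lt_trichotomy p q with h1 | rfl | h1
    · exact h1
    · exact absurd h.1 h.2
    · exact absurd h (not_ltIt (bb_ltIt hq h1 hp1))
  refine ⟨bb '' Set.Icc 0 1, ?_, ?_, ⟨?_, ?_⟩, ?_, ?_, ?_⟩
  · rintro _ ⟨q, ⟨hq, hq1⟩, rfl⟩
    exact ⟨fun n => ⟨bb_bound n, bb_mono hq (Nat.le_succ n)⟩, aa q, aa_mono hq, aa_econs hq,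
      aa_two hq, aa_plog, rfl⟩
  · rintro _ ⟨p, ⟨hp, hp1⟩, rfl⟩ _ ⟨q, ⟨hq, hq1⟩, rfl⟩
    rcases lt_trichotomy p q with h1 | rfl | h1
    · left
      refine ⟨0, ?_⟩
      refine squeeze_zero' (Eventually.of_forall fun n => by positivity) ?_
        (tendsto_one_div_atTop_nhds_zero_nat (𝕜 := ℝ))
      filter_upwards [aa_step hp h1 hq1, eventually_ge_atTop 1] with n h2 h3
      have hn : (0 : ℝ) < n := by exact_mod_cast h3
      rw [div_le_div_iff₀ (bb_pos h3) hn]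
      linarith
    · left
      refine ⟨1, tendsto_const_nhds.congr' ?_⟩
      filter_upwards [eventually_ge_atTop 1] with n h3
      exact (div_self (bb_pos h3).ne').symm
    · right
      refine tendsto_atTop_mono' _ ?_ (tendsto_natCast_atTop_atTop (R := ℝ))
      filter_upwards [aa_step hq h1 hp1, eventually_ge_atTop 1] with n h2 h3
      rwa [le_div_iff₀ (bb_pos h3)]
  · refine ⟨0, by simp, ?_⟩
    funext n
    simp [bb, aa, ff]
  · refine ⟨1, by simp, ?_⟩
    funext n
    simp [bb, aa]
  · rintro _ ⟨p, ⟨hp, hp1⟩, rfl⟩ _ ⟨q, ⟨hq, hq1⟩, rfl⟩ hne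
    rcases lt_trichotomy p q with h1 | rfl | h1
    · exact Or.inl (bb_ltIt hp h1 hq1)
    · exact absurd rfl hne
    · exact Or.inr (bb_ltIt hq h1 hp1)
  · rintro _ ⟨p, ⟨hp, hp1⟩, rfl⟩ _ ⟨q, ⟨hq, hq1⟩, rfl⟩ h
    have h1 := key p q hp hq hp1 hq1 h
    obtain ⟨r, hr, hr'⟩ := exists_between h1
    exact ⟨bb r, ⟨r, ⟨by linarith, by linarith⟩, rfl⟩, bb_ltIt hp hr (by linarith),
      bb_ltIt (by linarith) hr' hq1⟩
  · rintro α₁ α₂ ⟨p, ⟨hp, hp1⟩, e1⟩ ⟨q, ⟨hq, hq1⟩, e2⟩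
    have f1 : ∀ n, 2 ≤ n → α₁ n = aa p n := fun n hn =>
      (Nat.pow_right_injective hn (congrFun e1 n)).symm
    have f2 : ∀ n, 2 ≤ n → α₂ n = aa q n := fun n hn =>
      (Nat.pow_right_injective hn (congrFun e2 n)).symm
    rw [← e1, ← e2]
    constructor
    · intro h
      exact powLL_congr (aa_powLL (key p q hp hq hp1 hq1 h) hq1) f1 f2
    · intro h
      exact bb_ltIt hp (powLL_lt hp hq hp1 (powLL_congr h (fun n hn => (f1 n hn).symm)
        (fun n hn => (f2 n hn).symm))) hq1
end
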